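/- Under the SCAR assumption, the per-class one-versus-rest risk R_k(f_k) = π_k E_{p(x|y=k)}[ℓ(f_k(x))] + (1−π_k) E_{p(x|y≠k)}[ℓ(−f_k(x))] can be rewritten as R_k(f_k) = E_{p(x|ȳ_k=1)}[(1−π_k)ℓ(−f_k(x)) + (π̄_k + π_k − 1)ℓ(f_k(x))] + (1−π̄_k) E_{p(x|ȳ_k=0)}[ℓ(f_k(x))]. -/

import Mathlib

open MeasureTheory

/-- under SCAR the per-class OVR risk
R_k(f_k) = π_k E_{p(x|y=k)}[ℓ(f_k)] + (1−π_k) E_{p(x|y≠k)}[ℓ(−f_k)]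
equals E_{p(x|ȳ_k=1)}[(1−π_k)ℓ(−f_k) + (π̄_k+π_k−1)ℓ(f_k)] + (1−π̄_k)E_{p(x|ȳ_k=0)}[ℓ(f_k)]. -/
theorem per_class_risk_rewrite
    {X : Type*} [MeasurableSpace X]
    (μP μN μbar1 μbar0 : Measure X)
    [IsProbabilityMeasure μP] [IsProbabilityMeasure μN]
    [IsProbabilityMeasure μbar1] [IsProbabilityMeasure μbar0]
    (π πbar : ℝ) (l : ℝ → ℝ) (f : X → ℝ)
    (hl : ∀ z, 0 ≤ l z)
    (hπ0 : 0 ≤ π) (hπ1 : π ≤ 1) (hπbar0 : 0 ≤ πbar) (hπbar1 : πbar ≤ 1)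
    -- SCAR: p(x|ȳ_k=1) = p(x|y≠k)
    (hscar : μbar1 = μN)
    -- both mixtures equal the marginal p(x)
    (hmix : (ENNReal.ofReal πbar) • μbar1 + (ENNReal.ofReal (1 - πbar)) • μbar0
      = (ENNReal.ofReal π) • μP + (ENNReal.ofReal (1 - π)) • μN)
    (hintP : Integrable (fun x => l (f x)) μP)
    (hintN : Integrable (fun x => l (f x)) μN)
    (hintN' : Integrable (fun x => l (-(f x))) μN)
    (hint0 : Integrable (fun x => l (f x)) μbar0) :
    π * ∫ x, l (f x) ∂μP + (1 - π) * ∫ x, l (-(f x)) ∂μN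
      = (∫ x, ((1 - π) * l (-(f x)) + (πbar + π - 1) * l (f x)) ∂μbar1)
        + (1 - πbar) * ∫ x, l (f x) ∂μbar0 := by
  have key := congrArg (fun μ => ∫ x, l (f x) ∂μ) hmix
  subst hscar
  rw [integral_add_measure (hintN.smul_measure ENNReal.ofReal_ne_top)
      (hint0.smul_measure ENNReal.ofReal_ne_top),
    integral_add_measure (hintP.smul_measure ENNReal.ofReal_ne_top)
      (hintN.smul_measure ENNReal.ofReal_ne_top)] at key
  simp only [integral_smul_measure, smul_eq_mul, ENNReal.toReal_ofReal hπ0,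
    ENNReal.toReal_ofReal hπbar0, ENNReal.toReal_ofReal (sub_nonneg.2 hπ1),
    ENNReal.toReal_ofReal (sub_nonneg.2 hπbar1)] at key
  rw [integral_add (hintN'.const_mul _) (hintN.const_mul _), integral_const_mul,
    integral_const_mul]
  linear_combination -key
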